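/- arXiv:math/0309364 — 3 statements merged into one kernel-verified Lean document; each statement's English description precedes it below -/
import Mathlib

section
/- Let (ρ,K) be an AY pair for the Coxeter system (W,S) and let v,w ∈ K. If there exists a ρ-feasible path (of any length) from v to w, then there exists a ρ-feasible geodesic from v to w. -/
open CoxeterSystem

variable {B W : Type*} [Group W] {M : CoxeterMatrix B}

/-- The basis vector `C_w` of the vector space `V_K` spanned by `{C_w : w ∈ K}`,
realized as finitely supported functions on the subtype `K`. -/
noncomputable def Cvec (F : Type*) [Field F] (K : Set W) (w : W) (hw : w ∈ K) : ↥K →₀ F :=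
  Finsupp.single ⟨w, hw⟩ 1

/-- An abstract Young (AY) pair: a representation `ρ` of `W` on `V_K` together with
coefficients `a, b` satisfying Axiom (A). -/
structure AYPair (cs : CoxeterSystem M W) (F : Type*) [Field F] (K : Set W) where
  ρ : Representation F W (↥K →₀ F)
  a : B → W → F
  b : B → W → F
  axiomA_mem : ∀ (i : B) (w : W) (hw : w ∈ K) (h : w * cs.simple i ∈ K),
    ρ (cs.simple i) (Cvec F K w hw) =
      a i w • Cvec F K w hw + b i w • Cvec F K (w * cs.simple i) h
  axiomA_not_mem : ∀ (i : B) (w : W) (hw : w ∈ K), w * cs.simple i ∉ K →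
    ρ (cs.simple i) (Cvec F K w hw) = a i w • Cvec F K w hw
  b_eq_zero : ∀ (i : B) (w : W), w ∈ K → w * cs.simple i ∉ K → b i w = 0

/-- A path in the right Cayley graph starting at `v`, given by a list of generators `l`,
is `ρ`-feasible if all its arcs are `ρ`-feasible: both endpoints of each arc
lie in `K` and the corresponding `b`-coefficient is nonzero. -/
def FeasiblePath {cs : CoxeterSystem M W} {F : Type*} [Field F] {K : Set W}
    (P : AYPair cs F K) (v : W) (l : List B) : Prop :=
  ∀ (n : ℕ) (hn : n < l.length),
    v * cs.wordProd (l.take n) ∈ K ∧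
    v * cs.wordProd (l.take (n + 1)) ∈ K ∧
    P.b (l.get ⟨n, hn⟩) (v * cs.wordProd (l.take n)) ≠ 0

/-- The span of `{C_w : w ∈ K'}` inside `V_K`. -/
noncomputable def spanOf (F : Type*) [Field F] (K : Set W) (K' : Set W) :
    Submodule F (↥K →₀ F) :=
  Submodule.span F {x | ∃ (w : W) (h : w ∈ K), w ∈ K' ∧ x = Cvec F K w h}

/-- Minimality of an AY pair: `K` is nonempty and it has no proper nonempty subset `K'`
such that `span{C_w : w ∈ K'}` is `ρ`-invariant. -/
def AYPair.Minimal {cs : CoxeterSystem M W} {F : Type*} [Field F] {K : Set W}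
    (P : AYPair cs F K) : Prop :=
  K.Nonempty ∧ ∀ K' : Set W, K' ⊆ K → K'.Nonempty →
    (∀ (g : W), ∀ x ∈ spanOf F K K', P.ρ g x ∈ spanOf F K K') → K' = K

open Classical in
/-- The coefficient of `C_y` in a vector of `V_K`, extended by zero to all `y`. -/
noncomputable def coeffAt {X F : Type*} [Field F] {K : Set X} (x : ↥K →₀ F) (y : X) : F :=
  if h : y ∈ K then x ⟨y, h⟩ else 0

section

variable {X F : Type*} [Field F] {K : Set X}

theorem coeffAt_of_mem (x : ↥K →₀ F) {y : X} (h : y ∈ K) : coeffAt x y = x ⟨y, h⟩ :=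
  dif_pos h

theorem coeffAt_of_notMem (x : ↥K →₀ F) {y : X} (h : y ∉ K) : coeffAt x y = 0 :=
  dif_neg h

theorem mem_of_coeffAt_ne_zero {x : ↥K →₀ F} {y : X} (h : coeffAt x y ≠ 0) : y ∈ K := by
  by_contra hy
  exact h (coeffAt_of_notMem x hy)

theorem coeffAt_zero (y : X) : coeffAt (0 : ↥K →₀ F) y = 0 := by
  simp [coeffAt]

theorem coeffAt_add (x x' : ↥K →₀ F) (y : X) :
    coeffAt (x + x') y = coeffAt x y + coeffAt x' y := by
  by_cases h : y ∈ K <;> simp [coeffAt, h]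

theorem coeffAt_smul (c : F) (x : ↥K →₀ F) (y : X) : coeffAt (c • x) y = c * coeffAt x y := by
  by_cases h : y ∈ K <;> simp [coeffAt, h]

theorem coeffAt_Cvec_self {w : X} (hw : w ∈ K) : coeffAt (Cvec F K w hw) w = 1 := by
  simp [coeffAt, hw, Cvec]

theorem coeffAt_Cvec_of_ne {w y : X} (hw : w ∈ K) (h : w ≠ y) :
    coeffAt (Cvec F K w hw) y = 0 := by
  by_cases hy : y ∈ K <;> simp [coeffAt, hy, Cvec, h]

theorem single_eq_smul_Cvec (w : ↥K) (c : F) :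
    Finsupp.single w c = c • Cvec F K w w.2 := by
  simp [Cvec]

end

section

variable {F : Type*} [Field F] {K : Set W} {cs : CoxeterSystem M W} (P : AYPair cs F K)

theorem AYPair.coeffAt_simple_Cvec (i : B) {w y : W} (hw : w ∈ K) (hy : y ∈ K) :
    coeffAt (P.ρ (cs.simple i) (Cvec F K w hw)) y =
      P.a i y * coeffAt (Cvec F K w hw) y +
        P.b i (y * cs.simple i) * coeffAt (Cvec F K w hw) (y * cs.simple i) := by
  have hne : ∀ z : W, z * cs.simple i ≠ z := fun z h => by
    have := cs.length_mul_simple_ne z i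
    rw [h] at this
    exact this rfl
  by_cases hwy : w = y
  · subst hwy
    rw [coeffAt_Cvec_self, coeffAt_Cvec_of_ne hw (hne w).symm]
    by_cases h : w * cs.simple i ∈ K
    · rw [P.axiomA_mem i w hw h, coeffAt_add, coeffAt_smul, coeffAt_smul, coeffAt_Cvec_self,
        coeffAt_Cvec_of_ne h (hne w)]
      ring
    · rw [P.axiomA_not_mem i w hw h, coeffAt_smul, coeffAt_Cvec_self]
      ring
  · rw [coeffAt_Cvec_of_ne hw hwy]
    by_cases hws : w = y * cs.simple i
    · subst hws
      have h : y * cs.simple i * cs.simple i ∈ K := by simpa using hy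
      rw [P.axiomA_mem i _ hw h, coeffAt_add, coeffAt_smul, coeffAt_smul, coeffAt_Cvec_self,
        coeffAt_Cvec_of_ne hw hwy]
      simp only [cs.simple_mul_simple_cancel_right, coeffAt_Cvec_self]
      ring
    · rw [coeffAt_Cvec_of_ne hw hws]
      have hws' : w * cs.simple i ≠ y := by
        rintro rfl
        exact hws (by simp)
      by_cases h : w * cs.simple i ∈ K
      · rw [P.axiomA_mem i w hw h, coeffAt_add, coeffAt_smul, coeffAt_smul,
          coeffAt_Cvec_of_ne hw hwy, coeffAt_Cvec_of_ne h hws']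
        ring
      · rw [P.axiomA_not_mem i w hw h, coeffAt_smul, coeffAt_Cvec_of_ne hw hwy]
        ring

theorem AYPair.coeffAt_simple (i : B) (x : ↥K →₀ F) {y : W} (hy : y ∈ K) :
    coeffAt (P.ρ (cs.simple i) x) y =
      P.a i y * coeffAt x y + P.b i (y * cs.simple i) * coeffAt x (y * cs.simple i) := by
  induction x using Finsupp.induction_linear with
  | zero => simp [coeffAt_zero]
  | add x x' hx hx' =>
    rw [map_add]
    simp only [coeffAt_add, hx, hx']
    ring
  | single w c =>
    rw [single_eq_smul_Cvec, map_smul]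
    simp only [coeffAt_smul, P.coeffAt_simple_Cvec i w.2 hy]
    ring

theorem AYPair.ρ_wordProd_concat_inv (l : List B) (i : B) (x : ↥K →₀ F) :
    P.ρ (cs.wordProd (l ++ [i]))⁻¹ x = P.ρ (cs.simple i) (P.ρ (cs.wordProd l)⁻¹ x) := by
  rw [cs.wordProd_append, cs.wordProd_singleton, mul_inv_rev, cs.inv_simple, map_mul]
  rfl

theorem AYPair.length_le_of_coeffAt_ne_zero {v : W} (hv : v ∈ K) (l : List B) {y : W}
    (h : coeffAt (P.ρ (cs.wordProd l)⁻¹ (Cvec F K v hv)) y ≠ 0) :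
    cs.length (v⁻¹ * y) ≤ l.length := by
  induction l using List.reverseRecOn generalizing y with
  | nil =>
    by_cases hvy : v = y
    · simp [hvy]
    · simp [coeffAt_Cvec_of_ne hv hvy] at h
  | append_singleton l i ih =>
    rw [P.ρ_wordProd_concat_inv] at h
    rw [P.coeffAt_simple i _ (mem_of_coeffAt_ne_zero h)] at h
    rw [List.length_append, List.length_singleton]
    by_cases h1 : coeffAt (P.ρ (cs.wordProd l)⁻¹ (Cvec F K v hv)) y = 0
    · rw [h1, mul_zero, zero_add] at h
      have h2 := ih (right_ne_zero_of_mul h)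
      rw [← mul_assoc] at h2
      have := cs.length_mul_simple (v⁻¹ * y) i
      omega
    · have := ih h1
      omega

theorem feasiblePath_concat_iff (v : W) (l : List B) (i : B) :
    FeasiblePath P v (l ++ [i]) ↔ FeasiblePath P v l ∧ v * cs.wordProd l ∈ K ∧
      v * cs.wordProd (l ++ [i]) ∈ K ∧ P.b i (v * cs.wordProd l) ≠ 0 := by
  constructor
  · intro h
    refine ⟨fun n hn => ?_, ?_⟩
    · have := h n (by simp; omega)
      rw [List.take_append_of_le_length hn.le, List.take_append_of_le_length hn] at this
      simpa [List.getElem_append_left hn] using this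
    · have := h l.length (by simp)
      rw [List.take_left, List.take_of_length_le (l := l ++ [i]) (by simp)] at this
      simpa using this
  · rintro ⟨h, h'⟩ n hn
    rw [List.length_append, List.length_singleton] at hn
    obtain hn' | rfl : n < l.length ∨ n = l.length := by omega
    · rw [List.take_append_of_le_length hn'.le, List.take_append_of_le_length hn']
      simpa [List.getElem_append_left hn'] using h n hn'
    · rw [List.take_left, List.take_of_length_le (l := l ++ [i]) (by simp)]
      simpa using h'

/-- A reduced path from `v` is feasible exactly when the coefficient of its endpoint in
`ρ((wordProd l)⁻¹) C_v` is nonzero. In particular feasibility depends only on the endpoint. -/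
theorem feasiblePath_iff_coeffAt_ne_zero {v : W} (hv : v ∈ K) {l : List B}
    (hl : cs.IsReduced l) :
    FeasiblePath P v l ↔
      coeffAt (P.ρ (cs.wordProd l)⁻¹ (Cvec F K v hv)) (v * cs.wordProd l) ≠ 0 := by
  induction l using List.reverseRecOn with
  | nil => simp [FeasiblePath, coeffAt_Cvec_self]
  | append_singleton l i ih =>
    have hl' : cs.IsReduced l := by simpa using hl.take l.length
    rw [feasiblePath_concat_iff, ih hl', P.ρ_wordProd_concat_inv]
    by_cases hy : v * cs.wordProd (l ++ [i]) ∈ K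
    · have h0 : coeffAt (P.ρ (cs.wordProd l)⁻¹ (Cvec F K v hv))
          (v * cs.wordProd (l ++ [i])) = 0 := by
        by_contra h
        have := P.length_le_of_coeffAt_ne_zero hv l h
        rw [inv_mul_cancel_left, hl.eq] at this
        simp at this
      have hs : v * cs.wordProd (l ++ [i]) * cs.simple i = v * cs.wordProd l := by
        simp [cs.wordProd_append, ← mul_assoc]
      rw [P.coeffAt_simple i _ hy, h0, mul_zero, zero_add, hs, mul_ne_zero_iff]
      exact ⟨fun h => ⟨h.2.2.2, h.1⟩, fun h => ⟨h.2, mem_of_coeffAt_ne_zero h.2, hy, h.1⟩⟩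
    · simp [hy, coeffAt_of_notMem]

theorem FeasiblePath.of_wordProd_eq {v : W} (hv : v ∈ K) {l l' : List B}
    (hl : cs.IsReduced l) (hl' : cs.IsReduced l') (h : cs.wordProd l = cs.wordProd l')
    (hf : FeasiblePath P v l) : FeasiblePath P v l' := by
  rw [feasiblePath_iff_coeffAt_ne_zero P hv hl']
  rw [feasiblePath_iff_coeffAt_ne_zero P hv hl] at hf
  rwa [← h]

theorem exists_isReduced_feasiblePath {v : W} (hv : v ∈ K) (l : List B)
    (hl : FeasiblePath P v l) :
    ∃ l' : List B, cs.IsReduced l' ∧ cs.wordProd l' = cs.wordProd l ∧ FeasiblePath P v l' := by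
  induction l using List.reverseRecOn with
  | nil => exact ⟨[], by simp [CoxeterSystem.IsReduced], rfl, hl⟩
  | append_singleton l i ih =>
    rw [feasiblePath_concat_iff] at hl
    obtain ⟨l', hred, hprod, hf⟩ := ih hl.1
    have hlen := hred.eq
    obtain h | h := cs.length_mul_simple (cs.wordProd l') i
    · refine ⟨l' ++ [i], ?_, by simp [cs.wordProd_append, hprod], ?_⟩
      · rw [CoxeterSystem.IsReduced, cs.wordProd_append, cs.wordProd_singleton, h, hlen]
        simp
      · rw [feasiblePath_concat_iff, cs.wordProd_append, hprod, ← cs.wordProd_append]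
        exact ⟨hf, hl.2⟩
    · obtain ⟨m, hm, hmprod⟩ := cs.exists_isReduced (cs.wordProd l' * cs.simple i)
      have hm' : cs.wordProd (m ++ [i]) = cs.wordProd l' := by
        simp [cs.wordProd_append, ← hmprod]
      have hmred : cs.IsReduced (m ++ [i]) := by
        rw [CoxeterSystem.IsReduced, hm', ← h, hmprod, hm.eq]
        simp
      have hfm := hf.of_wordProd_eq P hv hred hmred hm'.symm
      rw [feasiblePath_concat_iff] at hfm
      exact ⟨m, hm, by rw [← hmprod, hprod]; simp [cs.wordProd_append], hfm.1⟩

end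

/-- if there is a `ρ`-feasible path (of any length) from `v` to `w`,
then there is a `ρ`-feasible geodesic from `v` to `w`. -/
theorem stmt1 (cs : CoxeterSystem M W) (F : Type*) [Field F] (K : Set W)
    (P : AYPair cs F K) (v w : W) (hv : v ∈ K) (hw : w ∈ K)
    (hex : ∃ l : List B, v * cs.wordProd l = w ∧ FeasiblePath P v l) :
    ∃ l : List B, v * cs.wordProd l = w ∧ l.length = cs.length (v⁻¹ * w) ∧
      FeasiblePath P v l := by
  obtain ⟨l, rfl, hl⟩ := hex
  obtain ⟨l', hred, hprod, hl'⟩ := exists_isReduced_feasiblePath P hv l hl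
  exact ⟨l', by rw [hprod], by rw [inv_mul_cancel_left, ← hprod, hred.eq], hl'⟩
end

section
/- Let (W,S) be a Coxeter system, A ⊆ T, w ∈ W, and let K = K_A(w) be the A-cell of w. Then T_K ⊆ T∖A and T_∂K ⊆ A; in particular, T_K ∩ T_∂K = ∅. -/
open CoxeterSystem

variable {B W : Type*} [Group W] {M : CoxeterMatrix B}

/-- The `A`-descent set of `w`: the reflections `t ∈ A` with `ℓ(tw) < ℓ(w)`. -/
def DesSet (cs : CoxeterSystem M W) (A : Set W) (w : W) : Set W :=
  {t | t ∈ A ∧ cs.length (t * w) < cs.length w}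

/-- The relation `w ↔_A ws`: one step along an edge `{w, ws}` of the right Cayley graph
with `w s w⁻¹ ∉ A`.  (This relation is symmetric.) -/
def AAdj (cs : CoxeterSystem M W) (A : Set W) (u v : W) : Prop :=
  ∃ i : B, v = u * cs.simple i ∧ u * cs.simple i * u⁻¹ ∉ A

/-- The relation `∼_A`: the reflexive-transitive closure of `↔_A`. -/
def ASim (cs : CoxeterSystem M W) (A : Set W) : W → W → Prop :=
  Relation.ReflTransGen (AAdj cs A)

/-- `T_K`: reflections of the form `w s w⁻¹` with `w ∈ K` and `ws ∈ K`. -/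
def TK (cs : CoxeterSystem M W) (K : Set W) : Set W :=
  {t | ∃ (i : B) (w : W), w ∈ K ∧ w * cs.simple i ∈ K ∧ t = w * cs.simple i * w⁻¹}

/-- `T_∂K`: reflections of the form `w s w⁻¹` with `w ∈ K` and `ws ∉ K`. -/
def TbK (cs : CoxeterSystem M W) (K : Set W) : Set W :=
  {t | ∃ (i : B) (w : W), w ∈ K ∧ w * cs.simple i ∉ K ∧ t = w * cs.simple i * w⁻¹}

lemma function_end_mul_apply {α : Type*} (f g : Function.End α) (a : α) :
    (f * g) a = f (g a) := rfl

open Classical in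
/-- The action of a simple reflection on pairs `(x, ε)`: conjugate `x` by `s i`, and flip the
sign `ε` exactly when `x = s i`. -/
noncomputable def signedConj (cs : CoxeterSystem M W) (i : B) : Function.End (W × ZMod 2) :=
  fun p ↦ (cs.simple i * p.1 * cs.simple i, p.2 + if p.1 = cs.simple i then 1 else 0)

lemma simple_mul_pow_simple_mul (cs : CoxeterSystem M W) (i j : B) (k : ℕ) :
    cs.simple j * (cs.simple i * cs.simple j) ^ k =
      ((cs.simple i * cs.simple j) ^ k)⁻¹ * cs.simple j := by
  have h : SemiconjBy (cs.simple j) (cs.simple i * cs.simple j)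
      (cs.simple i * cs.simple j)⁻¹ := by
    simp [SemiconjBy, mul_assoc]
  simpa only [SemiconjBy, inv_pow] using (h.pow_right k).eq

open Classical in
lemma signedConj_mul_pow_apply (cs : CoxeterSystem M W) (i j : B) (k : ℕ) (p : W × ZMod 2) :
    ((signedConj cs i * signedConj cs j) ^ k) p =
      ((cs.simple i * cs.simple j) ^ k * p.1 * ((cs.simple i * cs.simple j) ^ k)⁻¹,
        p.2 + ∑ l ∈ Finset.range (2 * k),
          if p.1 = ((cs.simple i * cs.simple j) ^ l)⁻¹ * cs.simple j then 1 else 0) := by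
  induction k with
  | zero => simp [Function.End.one_def]
  | succ k ih =>
    have hs := simple_mul_pow_simple_mul cs i j k
    set r := cs.simple i * cs.simple j with hr
    have hrinv : r⁻¹ = cs.simple j * cs.simple i := by simp [hr]
    have even_iff : r ^ k * p.1 * (r ^ k)⁻¹ = cs.simple j ↔
        p.1 = (r ^ (2 * k))⁻¹ * cs.simple j := by
      rw [mul_inv_eq_iff_eq_mul, hs, ← eq_inv_mul_iff_mul_eq, two_mul, pow_add, mul_inv_rev,
        mul_assoc]
    have odd_iff : cs.simple j * (r ^ k * p.1 * (r ^ k)⁻¹) * cs.simple j = cs.simple i ↔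
        p.1 = (r ^ (2 * k + 1))⁻¹ * cs.simple j := by
      have h₁ : cs.simple j * (r ^ k * p.1 * (r ^ k)⁻¹) * cs.simple j = cs.simple i ↔
          r ^ k * p.1 * (r ^ k)⁻¹ = r⁻¹ * cs.simple j := by
        rw [← eq_mul_inv_iff_mul_eq, ← eq_inv_mul_iff_mul_eq, hrinv]
        simp [mul_assoc]
      rw [h₁, mul_inv_eq_iff_eq_mul, mul_assoc, hs, ← eq_inv_mul_iff_mul_eq]
      have h₂ : (r ^ k)⁻¹ * (r⁻¹ * ((r ^ k)⁻¹ * cs.simple j)) =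
          (r ^ (2 * k + 1))⁻¹ * cs.simple j := by
        simp only [← mul_assoc, ← mul_inv_rev, ← pow_succ, ← pow_add]
        congr 3
        omega
      rw [h₂]
    rw [pow_succ', function_end_mul_apply, ih]
    simp only [function_end_mul_apply, signedConj]
    refine Prod.ext ?_ ?_
    · simp [pow_succ', hr, mul_assoc]
    · rw [show 2 * (k + 1) = 2 * k + 1 + 1 by ring, Finset.sum_range_succ, Finset.sum_range_succ]
      simp only [even_iff, odd_iff, add_assoc]

lemma signedConj_isLiftable (cs : CoxeterSystem M W) : M.IsLiftable (signedConj cs) := by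
  classical
  intro i j
  funext p
  rw [signedConj_mul_pow_apply, two_mul, Finset.sum_range_add]
  simp only [pow_add, cs.simple_mul_simple_pow, one_mul, CharTwo.add_self_eq_zero]
  simp [Function.End.one_def]

/-- The parity of the number of times that a walk in the right Cayley graph from `1` to `w`
crosses an edge labelled by the reflection `t`. -/
noncomputable def crossingParity (cs : CoxeterSystem M W) (t w : W) : ZMod 2 :=
  (cs.lift ⟨signedConj cs, signedConj_isLiftable cs⟩ w⁻¹ (t, 0)).2

lemma lift_signedConj_apply_fst (cs : CoxeterSystem M W) (w : W) (p : W × ZMod 2) :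
    (cs.lift ⟨signedConj cs, signedConj_isLiftable cs⟩ w p).1 = w * p.1 * w⁻¹ := by
  induction w using cs.simple_induction_left with
  | one => simp [Function.End.one_def]
  | mul_simple_left w i ih =>
    rw [map_mul, cs.lift_apply_simple, function_end_mul_apply]
    simp [signedConj, ih, mul_assoc]

open Classical in
lemma crossingParity_mul_simple (cs : CoxeterSystem M W) (t w : W) (i : B) :
    crossingParity cs t (w * cs.simple i) =
      crossingParity cs t w + if t = w * cs.simple i * w⁻¹ then 1 else 0 := by
  have h : w⁻¹ * t * w⁻¹⁻¹ = cs.simple i ↔ t = w * cs.simple i * w⁻¹ := by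
    rw [inv_inv, mul_assoc, inv_mul_eq_iff_eq_mul, eq_mul_inv_iff_mul_eq]
  simp only [crossingParity]
  rw [mul_inv_rev, cs.inv_simple, map_mul, cs.lift_apply_simple, function_end_mul_apply]
  simp only [signedConj, lift_signedConj_apply_fst, h]

lemma ASim.crossingParity_eq {cs : CoxeterSystem M W} {A : Set W} {t u v : W} (ht : t ∈ A)
    (h : ASim cs A u v) : crossingParity cs t v = crossingParity cs t u := by
  induction h with
  | refl => rfl
  | tail _ hstep ih =>
    obtain ⟨i, rfl, hi⟩ := hstep
    rw [crossingParity_mul_simple, if_neg fun h ↦ hi (by rwa [← h]), add_zero, ih]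

/-- for the `A`-cell `K = K_A(w)` one has `T_K ⊆ T \ A` and `T_∂K ⊆ A`;
in particular `T_K ∩ T_∂K = ∅`. -/
theorem stmt7 (cs : CoxeterSystem M W) (A : Set W)
    (hA : ∀ t ∈ A, cs.IsReflection t) (w : W) :
    (∀ t ∈ TK cs {v | ASim cs A w v}, cs.IsReflection t ∧ t ∉ A) ∧
    (∀ t ∈ TbK cs {v | ASim cs A w v}, t ∈ A) ∧
    TK cs {v | ASim cs A w v} ∩ TbK cs {v | ASim cs A w v} = ∅ := by
  have hTK : ∀ t ∈ TK cs {v | ASim cs A w v}, cs.IsReflection t ∧ t ∉ A := by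
    rintro t ⟨i, u, hu, hus, rfl⟩
    refine ⟨⟨u, i, rfl⟩, fun ht ↦ ?_⟩
    have h := (ASim.crossingParity_eq ht hus).trans (ASim.crossingParity_eq ht hu).symm
    rw [crossingParity_mul_simple, if_pos rfl] at h
    simp at h
  have hTbK : ∀ t ∈ TbK cs {v | ASim cs A w v}, t ∈ A := by
    rintro t ⟨i, u, hu, hus, rfl⟩
    by_contra ht
    exact hus (hu.tail ⟨i, rfl, ht⟩)
  refine ⟨hTK, hTbK, ?_⟩
  ext t
  simp only [Set.mem_inter_iff, Set.mem_empty_iff_false, iff_false, not_and]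
  exact fun h h' ↦ (hTK t h).2 (hTbK t h')
end

section
/- Let (W,S) be a Coxeter system, A ⊆ T, w ∈ W, K = K_A(w) the A-cell of w, and t ∈ T_∂K. If (w₁,s₁),(w₂,s₂) ∈ K×S satisfy w₁s₁w₁⁻¹ = w₂s₂w₂⁻¹ = t, then w₁s₁ ∉ K, w₂s₂ ∉ K, and the differences ℓ(w₁s₁) − ℓ(w₁) and ℓ(w₂s₂) − ℓ(w₂) have the same sign (both equal +1 or both equal −1). -/
open CoxeterSystem

variable {B W : Type*} [Group W] {M : CoxeterMatrix B}

namespace CoxeterSystem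

/-- In a group with involutions `a`, `b`, conjugation by powers of `a * b` carries the element
`t` to `b` or `b * a * b` according to whether `t` is a prescribed alternating product. -/
theorem conj_pow_eq_iff {G : Type*} [Group G] {a b : G} (ha : a * a = 1)
    (hb : b * b = 1) (t : G) (k : ℕ) :
    ((a * b) ^ k * t * ((a * b) ^ k)⁻¹ = b ↔ t = b * (a * b) ^ (2 * k)) ∧
      ((a * b) ^ k * t * ((a * b) ^ k)⁻¹ = b * a * b ↔ t = b * (a * b) ^ (2 * k + 1)) := by
  have hb' : b⁻¹ = b := inv_eq_of_mul_eq_one_left hb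
  have ha' : a⁻¹ = a := inv_eq_of_mul_eq_one_left ha
  have key : ((a * b) ^ k)⁻¹ * b = b * (a * b) ^ k := by
    have h : SemiconjBy b (a * b) (a * b)⁻¹ := by
      simp [SemiconjBy, mul_assoc, ha', hb']
    simpa only [inv_pow] using (h.pow_right k).eq.symm
  have aux (x : G) : (a * b) ^ k * t * ((a * b) ^ k)⁻¹ = x ↔
      t = ((a * b) ^ k)⁻¹ * x * (a * b) ^ k := by
    constructor
    · rintro rfl
      group
    · rintro rfl
      group
  constructor
  · rw [aux, key, mul_assoc, ← pow_add, two_mul]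
  · rw [aux, mul_assoc b a b, ← mul_assoc _ b (a * b), key, mul_assoc, mul_assoc, ← pow_succ',
      ← pow_add]
    congr! 3
    ring

open Classical in
/-- The action of the simple reflection `s i` on `W × {±1}`, which conjugates the first
coordinate and flips the sign exactly on `s i`. -/
noncomputable def signedConj (cs : CoxeterSystem M W) (i : B) : Function.End (W × ZMod 2) :=
  fun p ↦ (cs.simple i * p.1 * cs.simple i, p.2 + if p.1 = cs.simple i then 1 else 0)

open Classical in
theorem signedConj_mul_pow_apply (cs : CoxeterSystem M W) (i j : B) (m : ℕ)
    (t : W) (z : ZMod 2) :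
    ((cs.signedConj i * cs.signedConj j) ^ m) (t, z) =
      ((cs.simple i * cs.simple j) ^ m * t * ((cs.simple i * cs.simple j) ^ m)⁻¹,
        z + ∑ n ∈ Finset.range (2 * m),
          if t = cs.simple j * (cs.simple i * cs.simple j) ^ n then 1 else 0) := by
  induction m with
  | zero => simp [Function.End.one_def]
  | succ m ih =>
    obtain ⟨h₁, h₂⟩ := conj_pow_eq_iff (cs.simple_mul_simple_self i)
      (cs.simple_mul_simple_self j) t m
    rw [pow_succ']
    change (cs.signedConj i) ((cs.signedConj j)
      (((cs.signedConj i * cs.signedConj j) ^ m) (t, z))) = _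
    rw [ih, mul_add_one, Finset.sum_range_succ, Finset.sum_range_succ]
    have h₃ (x : W) : cs.simple j * x * cs.simple j = cs.simple i ↔
        x = cs.simple j * cs.simple i * cs.simple j := by
      constructor
      · intro h
        simp [← h, mul_assoc]
      · rintro rfl
        simp [mul_assoc]
    simp only [signedConj, h₃, h₁, h₂]
    ext
    · simp [pow_succ', mul_assoc]
    · simp [add_assoc]

theorem isLiftable_signedConj (cs : CoxeterSystem M W) : M.IsLiftable cs.signedConj := by
  classical
  intro i j
  funext ⟨t, z⟩
  rw [signedConj_mul_pow_apply, two_mul, Finset.sum_range_add]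
  simp [pow_add, CharTwo.add_self_eq_zero, Function.End.one_def]

/-- The parity of the number of occurrences of `t` in the right inversion sequence of any
word for `w`. -/
noncomputable def inversionParity (cs : CoxeterSystem M W) (w t : W) : ZMod 2 :=
  (cs.lift ⟨cs.signedConj, cs.isLiftable_signedConj⟩ w (t, 0)).2

theorem lift_signedConj_apply (cs : CoxeterSystem M W) (w t : W) (z : ZMod 2) :
    cs.lift ⟨cs.signedConj, cs.isLiftable_signedConj⟩ w (t, z) =
      (w * t * w⁻¹, z + cs.inversionParity w t) := by
  induction w using cs.simple_induction_left generalizing z with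
  | one => simp [inversionParity, Function.End.one_def]
  | mul_simple_left w i ih =>
    have h (y : ZMod 2) := calc
      cs.lift ⟨cs.signedConj, cs.isLiftable_signedConj⟩ (cs.simple i * w) (t, y)
      _ = cs.signedConj i (cs.lift ⟨cs.signedConj, cs.isLiftable_signedConj⟩ w (t, y)) := by
        rw [map_mul, lift_apply_simple]
        rfl
      _ = _ := by rw [ih]
    rw [inversionParity, h, h]
    simp [signedConj, mul_assoc, add_assoc]

theorem inversionParity_mul (cs : CoxeterSystem M W) (u v t : W) :
    cs.inversionParity (u * v) t =
      cs.inversionParity v t + cs.inversionParity u (v * t * v⁻¹) := by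
  rw [inversionParity, map_mul]
  change (cs.lift ⟨cs.signedConj, cs.isLiftable_signedConj⟩ u
    (cs.lift ⟨cs.signedConj, cs.isLiftable_signedConj⟩ v (t, 0))).2 = _
  simp [lift_signedConj_apply]

theorem inversionParity_one (cs : CoxeterSystem M W) (t : W) : cs.inversionParity 1 t = 0 := by
  simp [inversionParity, Function.End.one_def]

open Classical in
theorem inversionParity_simple (cs : CoxeterSystem M W) (i : B) (t : W) :
    cs.inversionParity (cs.simple i) t = if t = cs.simple i then 1 else 0 := by
  simp [inversionParity, signedConj]

theorem IsReflection.inversionParity_self {cs : CoxeterSystem M W} {t : W}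
    (ht : cs.IsReflection t) : cs.inversionParity t t = 1 := by
  obtain ⟨u, i, rfl⟩ := ht
  have h := cs.inversionParity_mul u u⁻¹ (u * cs.simple i * u⁻¹)
  rw [mul_inv_cancel, inversionParity_one] at h
  rw [inversionParity_mul, inversionParity_mul]
  simp only [mul_assoc, inv_inv, inv_mul_cancel_left, inv_mul_cancel, mul_one, one_mul,
    simple_mul_simple_self, inv_simple, inversionParity_simple, if_true] at h ⊢
  linear_combination -h

theorem mem_rightInvSeq_of_inversionParity_ne_zero (cs : CoxeterSystem M W) {ω : List B} {t : W}
    (h : cs.inversionParity (cs.wordProd ω) t ≠ 0) : t ∈ cs.rightInvSeq ω := by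
  induction ω with
  | nil => simp [inversionParity_one] at h
  | cons i ω ih =>
    rw [wordProd_cons, inversionParity_mul, inversionParity_simple] at h
    rw [rightInvSeq, List.mem_cons]
    split_ifs at h with hi
    · left
      rw [← hi]
      group
    · exact Or.inr (ih (by simpa using h))

theorem isRightInversion_of_inversionParity_ne_zero (cs : CoxeterSystem M W) {w t : W}
    (h : cs.inversionParity w t ≠ 0) : cs.IsRightInversion w t := by
  obtain ⟨ω, hω, rfl⟩ := cs.exists_isReduced w
  exact cs.isRightInversion_of_mem_rightInvSeq hω
    (cs.mem_rightInvSeq_of_inversionParity_ne_zero h)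

theorem IsReflection.isRightInversion_iff_inversionParity_ne_zero {cs : CoxeterSystem M W}
    {t : W} (ht : cs.IsReflection t) (w : W) :
    cs.IsRightInversion w t ↔ cs.inversionParity w t ≠ 0 := by
  refine ⟨fun h h₀ ↦ ?_, cs.isRightInversion_of_inversionParity_ne_zero⟩
  refine ht.isRightInversion_mul_left_iff.mp
    (cs.isRightInversion_of_inversionParity_ne_zero ?_) h
  simp [inversionParity_mul, ht.inversionParity_self, h₀]

open Classical in
theorem inversionParity_inv_mul_simple (cs : CoxeterSystem M W) (v t : W) (i : B) :
    cs.inversionParity (v * cs.simple i)⁻¹ t =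
      cs.inversionParity v⁻¹ t + if v * cs.simple i * v⁻¹ = t then 1 else 0 := by
  have h : v⁻¹ * t * v = cs.simple i ↔ v * cs.simple i * v⁻¹ = t := by
    constructor
    · intro h
      rw [← h]
      group
    · rintro rfl
      group
  rw [mul_inv_rev, inv_simple, inversionParity_mul, inversionParity_simple, inv_inv]
  simp only [h]

theorem length_lt_length_mul_simple_iff (cs : CoxeterSystem M W) (v : W) (i : B) :
    cs.length v < cs.length (v * cs.simple i) ↔
      cs.inversionParity v⁻¹ (v * cs.simple i * v⁻¹) = 0 := by
  have ht : cs.IsReflection (v * cs.simple i * v⁻¹) := ⟨v, i, rfl⟩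
  rw [← not_iff_not, ← ne_eq (cs.inversionParity _ _),
    ← ht.isRightInversion_iff_inversionParity_ne_zero, isRightInversion_inv_iff,
    IsLeftInversion, inv_mul_cancel_right, not_lt]
  exact ⟨fun h ↦ ⟨ht, h.lt_of_ne (cs.length_mul_simple_ne v i)⟩, fun h ↦ h.2.le⟩

end CoxeterSystem

theorem ASim.inversionParity_inv_eq {cs : CoxeterSystem M W} {A : Set W} {u v t : W}
    (h : ASim cs A u v) (ht : t ∈ A) :
    cs.inversionParity v⁻¹ t = cs.inversionParity u⁻¹ t := by
  induction h with
  | refl => rfl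
  | @tail x _ _ hadj ih =>
    obtain ⟨i, rfl, hi⟩ := hadj
    have hne : x * cs.simple i * x⁻¹ ≠ t := fun h ↦ hi (h ▸ ht)
    rw [inversionParity_inv_mul_simple, ih, if_neg hne, add_zero]

theorem ASim.mul_simple_not_asim {cs : CoxeterSystem M W} {A : Set W} {u v : W} {i : B}
    (h : ASim cs A u v) (hi : v * cs.simple i * v⁻¹ ∈ A) :
    ¬ASim cs A u (v * cs.simple i) := by
  intro h'
  have := h'.inversionParity_inv_eq hi
  rw [inversionParity_inv_mul_simple, h.inversionParity_inv_eq hi, if_pos rfl] at this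
  simp at this

/-- for `t ∈ T_∂K`, the edges labeled `t` always go out of the `A`-cell
`K = K_A(w)` in the same direction. -/
theorem stmt8 (cs : CoxeterSystem M W) (A : Set W)
    (hA : ∀ t ∈ A, cs.IsReflection t) (w : W) (t : W)
    (ht : t ∈ TbK cs {v | ASim cs A w v})
    (w₁ w₂ : W) (i₁ i₂ : B)
    (hw₁ : w₁ ∈ {v | ASim cs A w v}) (hw₂ : w₂ ∈ {v | ASim cs A w v})
    (ht₁ : w₁ * cs.simple i₁ * w₁⁻¹ = t) (ht₂ : w₂ * cs.simple i₂ * w₂⁻¹ = t) :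
    w₁ * cs.simple i₁ ∉ {v | ASim cs A w v} ∧
    w₂ * cs.simple i₂ ∉ {v | ASim cs A w v} ∧
    (cs.length w₁ < cs.length (w₁ * cs.simple i₁) ↔
      cs.length w₂ < cs.length (w₂ * cs.simple i₂)) := by
  have htA : t ∈ A := by
    obtain ⟨i, v, hv, hvi, rfl⟩ := ht
    by_contra h
    exact hvi (Relation.ReflTransGen.tail hv ⟨i, rfl, h⟩)
  refine ⟨ASim.mul_simple_not_asim hw₁ (ht₁ ▸ htA), ASim.mul_simple_not_asim hw₂ (ht₂ ▸ htA), ?_⟩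
  rw [length_lt_length_mul_simple_iff, length_lt_length_mul_simple_iff, ht₁, ht₂,
    ASim.inversionParity_inv_eq hw₁ htA, ASim.inversionParity_inv_eq hw₂ htA]
end
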